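/- arXiv:1501.06381 — 4 statements merged into one kernel-verified Lean document; each statement's English description precedes it below -/
import Mathlib

section
/- Let K be a compact Hausdorff space that is not hereditarily separable (i.e., some subspace of K is not separable). Then K admits an uncountable linked family of closed pairs, and hence the closed unit ball of C(K) contains an uncountable 2-equilateral set. -/
/-- A family of pairs `(A i, B i)` of subsets of a set is *linked* if the members of each
pair are disjoint, each pair has nonempty union, and for distinct indices `i ≠ j` either
`A i` meets `B j` or `A j` meets `B i`. -/
def IsLinked {Γ ι : Type*} (A B : ι → Set Γ) : Prop :=
  (∀ i, A i ∩ B i = ∅) ∧ (∀ i, (A i ∪ B i).Nonempty) ∧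
    ∀ i j, i ≠ j → (A i ∩ B j).Nonempty ∨ (A j ∩ B i).Nonempty

/-- There is an uncountable well-ordered type, in any universe, all of whose proper initial
segments are countable. -/
theorem exists_uncountable_wellOrder_countable_Iio :
    ∃ (ι : Type u) (_ : LinearOrder ι) (_ : WellFoundedLT ι),
      ¬ Countable ι ∧ ∀ i : ι, (Set.Iio i).Countable := by
  refine ⟨(Cardinal.aleph 1).ord.ToType, inferInstance, inferInstance, fun hc => ?_, fun i => ?_⟩
  · have h := Cardinal.mk_le_aleph0_iff.mpr hc
    rw [Cardinal.mk_ord_toType] at h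
    exact absurd h (not_le.mpr Cardinal.aleph0_lt_aleph_one)
  · rw [← Cardinal.le_aleph0_iff_set_countable, ← Cardinal.lt_aleph_one_iff]
    simpa using Cardinal.mk_Iio_lt i

/-- If every initial segment of a well-order is countable, then any space which is not separable
contains a sequence indexed by it, none of whose terms lies in the closure of the earlier ones. -/
theorem exists_leftSeparated_of_not_separableSpace {X ι : Type*} [TopologicalSpace X]
    [LinearOrder ι] [WellFoundedLT ι] (hι : ∀ i : ι, (Set.Iio i).Countable)
    (hX : ¬ TopologicalSpace.SeparableSpace X) :
    ∃ x : ι → X, ∀ i, x i ∉ closure (x '' Set.Iio i) := by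
  have hex (s : Set X) (hs : s.Countable) : ∃ y, y ∉ closure s := by
    by_contra! hc
    exact hX ⟨s, hs, hc⟩
  have : Nonempty X := (hex ∅ Set.countable_empty).nonempty
  have hex' (s : Set X) : ∃ y, s.Countable → y ∉ closure s := by
    by_cases hs : s.Countable
    · exact (hex s hs).imp fun _ hy _ => hy
    · exact ⟨Classical.arbitrary X, fun h => absurd h hs⟩
  choose c hc using hex'
  let x : ι → X := (wellFounded_lt (α := ι)).fix fun i f =>
    c (Set.range fun j : Set.Iio i => f j.1 j.2)
  have hx (i : ι) : x i = c (x '' Set.Iio i) := by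
    rw [Set.image_eq_range]
    exact (wellFounded_lt (α := ι)).fix_eq _ i
  exact ⟨x, fun i => hx i ▸ hc _ ((hι i).image x)⟩

/-- A left-separated sequence gives a linked family of pairs. -/
theorem isLinked_of_leftSeparated {X ι : Type*} [TopologicalSpace X] [LinearOrder ι]
    {x : ι → X} (hx : ∀ i, x i ∉ closure (x '' Set.Iio i)) :
    IsLinked (fun i => {x i}) (fun i => closure (x '' Set.Iio i)) := by
  have key {i j : ι} (hij : i < j) : ({x i} ∩ closure (x '' Set.Iio j)).Nonempty :=
    ⟨x i, rfl, subset_closure ⟨i, hij, rfl⟩⟩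
  exact ⟨fun i => Set.singleton_inter_eq_empty.mpr (hx i), fun i => ⟨x i, Or.inl rfl⟩,
    fun i j hij => hij.lt_or_gt.imp key key⟩

/-- A linked family of closed pairs in a compact Hausdorff space `K` yields a family in the closed
unit ball of `C(K)` whose members are pairwise at distance `2`. -/
theorem IsLinked.exists_dist_eq_two {K ι : Type*} [TopologicalSpace K] [CompactSpace K]
    [T2Space K] {A B : ι → Set K} (hAB : IsLinked A B) (hA : ∀ i, IsClosed (A i))
    (hB : ∀ i, IsClosed (B i)) :
    ∃ f : ι → C(K, ℝ), (∀ i, f i ∈ Metric.closedBall 0 1) ∧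
      ∀ i j, i ≠ j → dist (f i) (f j) = 2 := by
  have hex (i : ι) : ∃ f : C(K, ℝ), (∀ x ∈ A i, f x = -1) ∧ (∀ x ∈ B i, f x = 1) ∧
      ∀ x, f x ∈ Set.Icc (-1 : ℝ) 1 := by
    obtain ⟨f, hfA, hfB, hf⟩ := exists_bounded_mem_Icc_of_closed_of_le (hA i) (hB i)
      (Set.disjoint_iff_inter_eq_empty.mpr (hAB.1 i)) (by norm_num : (-1 : ℝ) ≤ 1)
    exact ⟨f.toContinuousMap, hfA, hfB, hf⟩
  choose f hfA hfB hf using hex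
  have hle (i j : ι) : dist (f i) (f j) ≤ 2 := by
    refine (ContinuousMap.dist_le zero_le_two).mpr fun x => ?_
    rw [Real.dist_eq, abs_le]
    constructor <;> linarith [(hf i x).1, (hf i x).2, (hf j x).1, (hf j x).2]
  have hge {i j : ι} (h : (A i ∩ B j).Nonempty) : 2 ≤ dist (f i) (f j) := by
    obtain ⟨x, hxA, hxB⟩ := h
    have hd := ContinuousMap.dist_apply_le_dist (f := f i) (g := f j) x
    rw [hfA i x hxA, hfB j x hxB, Real.dist_eq] at hd
    norm_num at hd
    exact hd
  refine ⟨f, fun i => ?_, fun i j hij => (hle i j).antisymm ?_⟩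
  · rw [Metric.mem_closedBall, ContinuousMap.dist_le zero_le_one]
    intro x
    simpa [Real.dist_eq, abs_le] using hf i x
  · rcases hAB.2.2 i j hij with h | h
    · exact hge h
    · exact dist_comm (f i) (f j) ▸ hge h

/-- Theorem 2(3): if a compact Hausdorff space `K` is not hereditarily separable (some
subspace of `K` is not separable), then `K` admits an uncountable linked family of closed
pairs, and the closed unit ball of `C(K)` contains an uncountable `2`-equilateral set. -/
theorem stmt5 {K : Type u} [TopologicalSpace K] [CompactSpace K] [T2Space K]
    (h : ∃ Y : Set K, ¬ TopologicalSpace.SeparableSpace Y) :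
    (∃ (ι : Type u) (A B : ι → Set K), (∀ i, IsClosed (A i)) ∧ (∀ i, IsClosed (B i)) ∧
      IsLinked A B ∧ ¬ Countable ι) ∧
    ∃ S : Set C(K, ℝ), S ⊆ Metric.closedBall 0 1 ∧ ¬ S.Countable ∧
      ∀ f ∈ S, ∀ g ∈ S, f ≠ g → dist f g = 2 := by
  obtain ⟨Y, hY⟩ := h
  obtain ⟨ι, _, _, hunc, hcount⟩ := exists_uncountable_wellOrder_countable_Iio.{u}
  obtain ⟨y, hy⟩ := exists_leftSeparated_of_not_separableSpace hcount hY
  let x : ι → K := fun i => y i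
  have hx (i : ι) : x i ∉ closure (x '' Set.Iio i) := by
    have hi := hy i
    rwa [closure_subtype, Set.image_image] at hi
  have hlink := isLinked_of_leftSeparated hx
  refine ⟨⟨ι, _, _, fun _ => isClosed_singleton, fun _ => isClosed_closure, hlink, hunc⟩, ?_⟩
  obtain ⟨f, hball, hdist⟩ :=
    hlink.exists_dist_eq_two (fun _ => isClosed_singleton) (fun _ => isClosed_closure)
  have hinj : Function.Injective f := by
    intro i j hij
    by_contra hne
    simpa [hij] using hdist i j hne
  refine ⟨Set.range f, Set.range_subset_iff.mpr hball, fun hc => hunc ?_, ?_⟩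
  · have := hc.to_subtype
    exact (Equiv.ofInjective f hinj).injective.countable
  · rintro _ ⟨i, rfl⟩ _ ⟨j, rfl⟩ hne
    exact hdist i j fun hij => hne (congrArg f hij)
end

section
/- Let K be a compact Hausdorff space carrying a Radon probability measure μ and an uncountable family {Γ_α : α < ω₁} of μ-measurable subsets of K that is stochastically independent, i.e., μ(ε₁Γ_{α₁} ∩ ⋯ ∩ ε_nΓ_{α_n}) = 1/2ⁿ for all α₁ < ⋯ < α_n and ε₁,…,ε_n ∈ {−1,1}, where 1·A = A and (−1)·A = K∖A. Then K admits an uncountable linked family of closed pairs (and hence the closed unit ball of C(K) contains an uncountable 2-equilateral set); in fact one can choose compact sets A_α ⊆ Γ_α and B_α ⊆ K∖Γ_α with μ(Γ_α∖A_α) < 1/8 and μ((K∖Γ_α)∖B_α) < 1/8, and then the family {(A_α, B_α) : α < ω₁} is linked, with μ(A_α ∩ B_β) > 0 and μ(A_β ∩ B_α) > 0 for all α ≠ β. -/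
open MeasureTheory

/-- If `P` and `Q` lose less than `1/8` of measure when cut down to `A` and `B`, and `P ∩ Q` has
measure `1/4`, then `A ∩ B` has positive measure. -/
theorem measure_inter_pos_of_diff_lt {X : Type*} [MeasurableSpace X] (μ : Measure X)
    {P Q A B : Set X} (hPQ : μ (P ∩ Q) = (2⁻¹ : ENNReal) ^ 2)
    (hA : μ (P \ A) < 8⁻¹) (hB : μ (Q \ B) < 8⁻¹) : 0 < μ (A ∩ B) := by
  rw [pos_iff_ne_zero]
  intro h0
  have hsub : P ∩ Q ⊆ (A ∩ B) ∪ ((P \ A) ∪ (Q \ B)) := by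
    rintro x ⟨hP, hQ⟩
    by_cases hxA : x ∈ A <;> by_cases hxB : x ∈ B <;> simp [*]
  have hlt : μ (P ∩ Q) < 8⁻¹ + 8⁻¹ :=
    calc μ (P ∩ Q) ≤ μ (A ∩ B) + μ ((P \ A) ∪ (Q \ B)) :=
          (measure_mono hsub).trans (measure_union_le _ _)
      _ ≤ μ (P \ A) + μ (Q \ B) := by
          rw [h0, zero_add]
          exact measure_union_le _ _
      _ < 8⁻¹ + 8⁻¹ := ENNReal.add_lt_add hA hB
  rw [hPQ] at hlt
  refine hlt.ne ?_
  rw [← ENNReal.toReal_eq_toReal_iff' (by simp) (by simp),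
    ENNReal.toReal_add (by simp) (by simp)]
  norm_num

/-- Two disjoint closed sets in a normal space are separated by a continuous function with values
in `[-1, 1]` equal to `1` on the first set and to `-1` on the second. -/
theorem exists_continuous_one_neg_one_of_isClosed {X : Type*} [TopologicalSpace X]
    [NormalSpace X] {A B : Set X} (hA : IsClosed A) (hB : IsClosed B) (hAB : Disjoint A B) :
    ∃ f : C(X, ℝ), (∀ x ∈ A, f x = 1) ∧ (∀ x ∈ B, f x = -1) ∧ ∀ x, |f x| ≤ 1 := by
  obtain ⟨g, hgB, hgA, hg⟩ := exists_continuous_zero_one_of_isClosed hB hA hAB.symm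
  refine ⟨⟨fun x => 2 * g x - 1, by fun_prop⟩, fun x hx => ?_, fun x hx => ?_, fun x => ?_⟩
  · have := hgA hx
    simp only [Pi.one_apply] at this
    simp only [ContinuousMap.coe_mk, this]
    norm_num
  · have := hgB hx
    simp only [Pi.zero_apply] at this
    simp [this]
  · obtain ⟨h0, h1⟩ := hg x
    simp only [ContinuousMap.coe_mk, abs_le]
    constructor <;> linarith

/-- An uncountable linked family of closed pairs in a compact Hausdorff space yields an
uncountable `2`-equilateral subset of the closed unit ball of the space of continuous
functions. -/
theorem IsLinked.exists_uncountable_equilateral {X ι : Type*} [TopologicalSpace X]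
    [CompactSpace X] [T2Space X] [Uncountable ι] {A B : ι → Set X} (h : IsLinked A B)
    (hA : ∀ i, IsClosed (A i)) (hB : ∀ i, IsClosed (B i)) :
    ∃ S : Set C(X, ℝ), S ⊆ Metric.closedBall 0 1 ∧ ¬ S.Countable ∧
      ∀ f ∈ S, ∀ g ∈ S, f ≠ g → dist f g = 2 := by
  obtain ⟨hdisj, -, hmeet⟩ := h
  choose f hfA hfB hf using fun i => exists_continuous_one_neg_one_of_isClosed (hA i) (hB i)
    (Set.disjoint_iff_inter_eq_empty.2 (hdisj i))
  have hle : ∀ i j, dist (f i) (f j) ≤ 2 := fun i j => by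
    rw [ContinuousMap.dist_le (by norm_num)]
    intro x
    have hi := abs_le.1 (hf i x)
    have hj := abs_le.1 (hf j x)
    rw [Real.dist_eq, abs_le]
    constructor <;> linarith
  have hge : ∀ i j, (A i ∩ B j).Nonempty → 2 ≤ dist (f i) (f j) := by
    rintro i j ⟨x, hxA, hxB⟩
    refine le_trans ?_ (ContinuousMap.dist_apply_le_dist x)
    rw [hfA i x hxA, hfB j x hxB, Real.dist_eq]
    norm_num
  have hdist : ∀ i j, i ≠ j → dist (f i) (f j) = 2 := fun i j hij =>
    (hle i j).antisymm <| (hmeet i j hij).elim (hge i j) fun hji =>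
      dist_comm (f i) (f j) ▸ hge j i hji
  have hinj : Function.Injective f := fun i j hij => by
    by_contra hne
    have := hdist i j hne
    rw [hij, dist_self] at this
    norm_num at this
  refine ⟨Set.range f, ?_, fun hc => ?_, ?_⟩
  · rintro _ ⟨i, rfl⟩
    rw [mem_closedBall_zero_iff, ContinuousMap.norm_le _ zero_le_one]
    exact hf i
  · have := hc.to_subtype
    exact not_countable (α := ι) (Set.rangeFactorization_injective.2 hinj).countable
  · rintro _ ⟨i, rfl⟩ _ ⟨j, rfl⟩ hne
    exact hdist i j (ne_of_apply_ne f hne)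

/-- Theorem 2(5): let `K` be a compact Hausdorff space carrying a Radon (inner regular Borel)
probability measure `μ` and a stochastically independent family `{Γ i : i ∈ ι}` of measurable
sets indexed by a set of cardinality `ℵ₁` (i.e. `μ(ε₁Γ_{i₁} ∩ ⋯ ∩ ε_nΓ_{i_n}) = 2⁻ⁿ` for
distinct indices and signs, where `+1·A = A`, `−1·A = Aᶜ`).  Then one can choose compact sets
`A i ⊆ Γ i` and `B i ⊆ (Γ i)ᶜ` with `μ (Γ i \ A i) < 1/8` and `μ ((Γ i)ᶜ \ B i) < 1/8` such
that the family `{(A i, B i)}` is linked, and in fact `μ (A i ∩ B j) > 0` and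
`μ (A j ∩ B i) > 0` for `i ≠ j`; consequently `K` admits an uncountable linked family of
closed pairs and the closed unit ball of `C(K)` contains an uncountable `2`-equilateral
set. -/
theorem stmt7 {K : Type u} [TopologicalSpace K] [CompactSpace K] [T2Space K]
    [MeasurableSpace K] [BorelSpace K]
    (μ : Measure K) [IsProbabilityMeasure μ] [μ.InnerRegular]
    {ι : Type u} (hι : Cardinal.mk ι = Cardinal.aleph 1)
    (G : ι → Set K) (hG : ∀ i, MeasurableSet (G i))
    (hind : ∀ (s : Finset ι) (ε : ι → Bool),
      μ (⋂ i ∈ s, cond (ε i) (G i) (G i)ᶜ) = (2⁻¹ : ENNReal) ^ s.card) :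
    (∃ A B : ι → Set K,
      (∀ i, IsCompact (A i)) ∧ (∀ i, IsCompact (B i)) ∧
      (∀ i, A i ⊆ G i) ∧ (∀ i, B i ⊆ (G i)ᶜ) ∧
      (∀ i, μ (G i \ A i) < 8⁻¹) ∧ (∀ i, μ ((G i)ᶜ \ B i) < 8⁻¹) ∧
      IsLinked A B ∧
      ∀ i j, i ≠ j → 0 < μ (A i ∩ B j) ∧ 0 < μ (A j ∩ B i)) ∧
    ∃ S : Set C(K, ℝ), S ⊆ Metric.closedBall 0 1 ∧ ¬ S.Countable ∧
      ∀ f ∈ S, ∀ g ∈ S, f ≠ g → dist f g = 2 := by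
  have hunc : Uncountable ι := by
    rw [← Cardinal.aleph0_lt_mk_iff, hι]
    exact Cardinal.aleph0_lt_aleph_one
  have h8 : (8⁻¹ : ENNReal) ≠ 0 := by simp
  choose A hAG hA hAlt using fun i =>
    (hG i).exists_isCompact_sdiff_lt (measure_ne_top μ (G i)) h8
  choose B hBG hB hBlt using fun i =>
    (hG i).compl.exists_isCompact_sdiff_lt (measure_ne_top μ (G i)ᶜ) h8
  have hquarter : ∀ i j, i ≠ j → μ (G i ∩ (G j)ᶜ) = (2⁻¹ : ENNReal) ^ 2 := by
    classical
    intro i j hij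
    have := hind {i, j} fun k => decide (k = i)
    rwa [Finset.card_pair hij, Finset.set_biInter_insert, Finset.set_biInter_singleton,
      decide_eq_true rfl, decide_eq_false hij.symm] at this
  have hpos : ∀ i j, i ≠ j → 0 < μ (A i ∩ B j) := fun i j hij =>
    measure_inter_pos_of_diff_lt μ (hquarter i j hij) (hAlt i) (hBlt j)
  have hlinked : IsLinked A B := by
    refine ⟨fun i => ?_, fun i => ?_, fun i j hij =>
      Or.inl (nonempty_of_measure_ne_zero (hpos i j hij).ne')⟩
    · exact Set.disjoint_iff_inter_eq_empty.1 (disjoint_compl_right.mono (hAG i) (hBG i))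
    · obtain ⟨j, hj⟩ := exists_ne i
      exact (nonempty_of_measure_ne_zero (hpos i j hj.symm).ne').mono
        (Set.inter_subset_left.trans Set.subset_union_left)
  exact ⟨⟨A, B, hA, hB, hAG, hBG, hAlt, hBlt, hlinked,
      fun i j hij => ⟨hpos i j hij, hpos j i hij.symm⟩⟩,
    hlinked.exists_uncountable_equilateral (fun i => (hA i).isClosed) fun i => (hB i).isClosed⟩
end

section
/- Let Γ be an infinite set. Then m(c₀(Γ)) = |Γ|, where c₀(Γ) is the Banach space of real-valued functions on Γ vanishing at infinity with the supremum norm; that is, the minimum cardinality of a maximal equilateral set in c₀(Γ) equals the cardinality of Γ. -/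
open scoped ZeroAtInfty

/-- A subset `S` of a metric space is `l`-equilateral if any two distinct points of `S` are
at distance `l`. -/
def IsEquilateralWith {M : Type*} [MetricSpace M] (S : Set M) (l : ℝ) : Prop :=
  ∀ x ∈ S, ∀ y ∈ S, x ≠ y → dist x y = l

/-- A subset of a metric space is equilateral if it is `l`-equilateral for some `l > 0`. -/
def IsEquilateral {M : Type*} [MetricSpace M] (S : Set M) : Prop :=
  ∃ l : ℝ, 0 < l ∧ IsEquilateralWith S l

/-- An equilateral set is maximal if it is not a proper subset of an equilateral set. -/
def IsMaximalEquilateral {M : Type*} [MetricSpace M] (S : Set M) : Prop :=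
  IsEquilateral S ∧ ∀ T : Set M, IsEquilateral T → S ⊆ T → T = S

/-- `mNum M` is the minimum cardinality of a maximal equilateral set in `M`. -/
noncomputable def mNum (M : Type*) [MetricSpace M] : Cardinal :=
  sInf {c : Cardinal | ∃ S : Set M, IsMaximalEquilateral S ∧ Cardinal.mk S = c}

section C0

variable {Γ : Type*} [TopologicalSpace Γ]

theorem C0.abs_sub_le_dist (f g : C₀(Γ, ℝ)) (γ : Γ) : |f γ - g γ| ≤ dist f g := by
  rw [← ZeroAtInftyContinuousMap.dist_toBCF_eq_dist, ← Real.dist_eq]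
  exact BoundedContinuousFunction.dist_coe_le_dist (f := f.toBCF) (g := g.toBCF) γ

theorem C0.dist_le {f g : C₀(Γ, ℝ)} {r : ℝ} (hr : 0 ≤ r) (h : ∀ γ, |f γ - g γ| ≤ r) :
    dist f g ≤ r := by
  rw [← ZeroAtInftyContinuousMap.dist_toBCF_eq_dist]
  exact (BoundedContinuousFunction.dist_le hr).2 fun γ => by
    rw [Real.dist_eq]; exact h γ

variable [DiscreteTopology Γ]

theorem C0.tendsto_cofinite (f : C₀(Γ, ℝ)) : Filter.Tendsto f Filter.cofinite (nhds 0) := by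
  rw [← Filter.cocompact_eq_cofinite]
  exact zero_at_infty f

theorem C0.finite_le_abs (f : C₀(Γ, ℝ)) {r : ℝ} (hr : 0 < r) : {γ | r ≤ |f γ|}.Finite := by
  have h := (C0.tendsto_cofinite f).eventually (Metric.ball_mem_nhds 0 hr)
  simpa [Filter.eventually_cofinite] using h

theorem C0.countable_support (f : C₀(Γ, ℝ)) : (Function.support f).Countable := by
  simpa [ker_nhds, Function.support, Set.compl_def] using
    (C0.tendsto_cofinite f).countable_compl_preimage_ker

/-- The distance in `C₀(Γ, ℝ)` is attained at some coordinate. -/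
theorem C0.exists_abs_sub_eq_dist [Nonempty Γ] (f g : C₀(Γ, ℝ)) :
    ∃ γ, |f γ - g γ| = dist f g := by
  rcases eq_or_ne f g with rfl | hne
  · simp
  have hd : 0 < dist f g := dist_pos.2 hne
  have hfin := C0.finite_le_abs (f - g) (half_pos hd)
  have hnon : {γ | dist f g / 2 ≤ |(f - g) γ|}.Nonempty := by
    by_contra! h
    have : dist f g ≤ dist f g / 2 := C0.dist_le (by positivity) fun γ => by
      by_contra! hγ
      exact (h ▸ Set.notMem_empty γ : γ ∉ {γ | dist f g / 2 ≤ |(f - g) γ|}) hγ.le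
    linarith
  obtain ⟨γ, hγ, hmax⟩ := Set.exists_max_image _ (fun γ => |(f - g) γ|) hfin hnon
  refine ⟨γ, (C0.abs_sub_le_dist f g γ).antisymm (C0.dist_le (abs_nonneg _) fun δ => ?_)⟩
  by_cases hδ : dist f g / 2 ≤ |(f - g) δ|
  · exact hmax δ hδ
  · exact (not_le.1 hδ).le.trans hγ

open Classical in
/-- The indicator function of a finite set, as an element of `C₀(Γ, ℝ)`. -/
noncomputable def C0.indicator (F : Finset Γ) : C₀(Γ, ℝ) where
  toFun γ := if γ ∈ F then 1 else 0
  continuous_toFun := continuous_of_discreteTopology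
  zero_at_infty' := by
    rw [Filter.cocompact_eq_cofinite]
    refine tendsto_const_nhds.congr' ?_
    filter_upwards [F.finite_toSet.compl_mem_cofinite] with γ hγ
    exact (if_neg hγ).symm

theorem C0.indicator_of_mem {F : Finset Γ} {γ : Γ} (h : γ ∈ F) : C0.indicator F γ = 1 :=
  if_pos h

theorem C0.indicator_of_notMem {F : Finset Γ} {γ : Γ} (h : γ ∉ F) : C0.indicator F γ = 0 :=
  if_neg h

theorem C0.dist_indicator {F G : Finset Γ} (h : F ≠ G) :
    dist (C0.indicator F) (C0.indicator G) = 1 := by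
  apply le_antisymm
  · refine C0.dist_le zero_le_one fun γ => ?_
    by_cases hF : γ ∈ F <;> by_cases hG : γ ∈ G <;>
      simp [C0.indicator_of_mem, C0.indicator_of_notMem, hF, hG]
  · obtain ⟨γ, hγ⟩ : ∃ γ, ¬(γ ∈ F ↔ γ ∈ G) := by
      by_contra! H
      exact h (Finset.ext H)
    refine le_trans (le_of_eq ?_) (C0.abs_sub_le_dist _ _ γ)
    by_cases hF : γ ∈ F <;> by_cases hG : γ ∈ G <;>
      simp_all [C0.indicator_of_mem, C0.indicator_of_notMem]

theorem C0.indicator_injective : Function.Injective (C0.indicator : Finset Γ → C₀(Γ, ℝ)) := by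
  intro F G h
  by_contra hne
  have := C0.dist_indicator hne
  simp [h] at this

theorem C0.isMaximalEquilateral_range_indicator [Nonempty Γ] :
    IsMaximalEquilateral (Set.range (C0.indicator : Finset Γ → C₀(Γ, ℝ))) := by
  refine ⟨⟨1, one_pos, ?_⟩, ?_⟩
  · rintro _ ⟨F, rfl⟩ _ ⟨G, rfl⟩ h
    exact C0.dist_indicator (ne_of_apply_ne _ h)
  rintro T ⟨l, -, hT⟩ hsub
  refine hsub.antisymm' fun x hx => ?_
  by_contra hxS
  obtain ⟨γ₀⟩ := ‹Nonempty Γ›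
  have hl : l = 1 := by
    have hne : ({γ₀} : Finset Γ) ≠ ∅ := Finset.singleton_ne_empty γ₀
    rw [← C0.dist_indicator hne]
    exact (hT _ (hsub ⟨_, rfl⟩) _ (hsub ⟨_, rfl⟩) (C0.indicator_injective.ne hne)).symm
  subst hl
  have hd (F : Finset Γ) : dist x (C0.indicator F) = 1 :=
    hT x hx _ (hsub ⟨F, rfl⟩) fun h => hxS ⟨F, h.symm⟩
  have hle (γ : Γ) : x γ ≤ 1 := by
    have h := C0.abs_sub_le_dist x (C0.indicator ∅) γ
    rw [hd, C0.indicator_of_notMem (Finset.notMem_empty γ), sub_zero] at h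
    exact (abs_le.1 h).2
  have hge (γ : Γ) : 0 ≤ x γ := by
    have h := C0.abs_sub_le_dist x (C0.indicator {γ}) γ
    rw [hd, C0.indicator_of_mem (Finset.mem_singleton_self γ)] at h
    linarith [(abs_le.1 h).1]
  have hfin := C0.finite_le_abs x one_pos
  have : Nonempty Γ := ⟨γ₀⟩
  obtain ⟨γ, hγ⟩ := C0.exists_abs_sub_eq_dist x (C0.indicator hfin.toFinset)
  rw [hd] at hγ
  by_cases h : γ ∈ hfin.toFinset
  · rw [C0.indicator_of_mem h] at hγ
    have h1 : 1 ≤ |x γ| := by simpa using h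
    rw [abs_of_nonneg (hge γ)] at h1
    rw [h1.antisymm' (hle γ)] at hγ
    simp at hγ
  · rw [C0.indicator_of_notMem h, sub_zero] at hγ
    exact h (by simp [hγ])

/-- An `l`-equilateral set `S` extends if some `s ∈ S` is largest in `S` at a coordinate `γ` that
is not needed to witness the distances from `s` to the other points. -/
theorem C0.exists_forall_dist_eq {S : Set C₀(Γ, ℝ)} {l : ℝ} (hl : 0 < l)
    (hS : IsEquilateralWith S l) {s : C₀(Γ, ℝ)} (hs : s ∈ S) {γ : Γ}
    (hmax : ∀ t ∈ S, t γ ≤ s γ)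
    (hwit : ∀ t ∈ S, t ≠ s → ∃ δ, δ ≠ γ ∧ |s δ - t δ| = l) :
    ∃ x, ∀ t ∈ S, dist x t = l := by
  set x : C₀(Γ, ℝ) := s - l • C0.indicator {γ} with hx
  have hxγ : x γ = s γ - l := by
    simp [hx, C0.indicator_of_mem (Finset.mem_singleton_self γ)]
  have hxδ {δ : Γ} (h : δ ≠ γ) : x δ = s δ := by
    simp [hx, C0.indicator_of_notMem (Finset.notMem_singleton.2 h)]
  refine ⟨x, fun t ht => ?_⟩
  have hst : dist s t ≤ l := by
    rcases eq_or_ne s t with rfl | h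
    · simpa using hl.le
    · exact (hS s hs t ht h).le
  apply le_antisymm
  · refine C0.dist_le hl.le fun δ => ?_
    have hδ := (C0.abs_sub_le_dist s t δ).trans hst
    rcases eq_or_ne δ γ with rfl | h
    · rw [hxγ, abs_le]
      constructor <;> linarith [hmax t ht, (abs_le.1 hδ).2]
    · rwa [hxδ h]
  · rcases eq_or_ne t s with rfl | h
    · refine le_trans (le_of_eq ?_) (C0.abs_sub_le_dist x t γ)
      rw [hxγ, sub_sub_cancel_left, abs_neg, abs_of_pos hl]
    · obtain ⟨δ, hδ, he⟩ := hwit t ht h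
      rw [← he, ← hxδ hδ]
      exact C0.abs_sub_le_dist x t δ

theorem C0.exists_coordinate_of_finite [Infinite Γ] {S : Set C₀(Γ, ℝ)} (hfin : S.Finite)
    (hne : S.Nonempty) {l : ℝ} (hS : IsEquilateralWith S l) :
    ∃ s ∈ S, ∃ γ, (∀ t ∈ S, t γ ≤ s γ) ∧
      ∀ t ∈ S, t ≠ s → ∃ δ, δ ≠ γ ∧ |s δ - t δ| = l := by
  have hmax (γ : Γ) : ∃ s : S, ∀ t ∈ S, t γ ≤ s.1 γ := by
    obtain ⟨s, hs, h⟩ := Set.exists_max_image S (fun s => s γ) hfin hne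
    exact ⟨⟨s, hs⟩, h⟩
  choose m hm using hmax
  have := hfin.to_subtype
  obtain ⟨s, hs⟩ := Finite.exists_infinite_fiber m
  choose w hw using C0.exists_abs_sub_eq_dist (Γ := Γ)
  obtain ⟨γ, hγ, hγw⟩ :=
    (Set.infinite_coe_iff.1 hs).exists_notMem_finite (hfin.image (w s.1))
  obtain rfl : m γ = s := hγ
  refine ⟨m γ, (m γ).2, γ, hm γ, fun t ht hts => ⟨w (m γ).1 t, ?_, ?_⟩⟩
  · exact fun h => hγw ⟨t, ht, h⟩
  · rw [hw, hS _ (m γ).2 t ht hts.symm]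

theorem C0.exists_coordinate_of_infinite {Γ : Type u} [TopologicalSpace Γ] [DiscreteTopology Γ]
    {S : Set C₀(Γ, ℝ)} (hinf : S.Infinite) (hcard : Cardinal.mk S < Cardinal.mk Γ)
    {l : ℝ} (hl : 0 < l) (hS : IsEquilateralWith S l) :
    ∃ s ∈ S, ∃ γ, (∀ t ∈ S, t γ ≤ s γ) ∧
      ∀ t ∈ S, t ≠ s → ∃ δ, δ ≠ γ ∧ |s δ - t δ| = l := by
  have := hinf.to_subtype
  obtain ⟨γ, hγ⟩ : ∃ γ, γ ∉ ⋃ s : S, Function.support s.1 := by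
    by_contra! h
    refine hcard.not_ge ?_
    rw [← Cardinal.mk_univ, ← Set.eq_univ_of_forall h]
    calc Cardinal.mk (⋃ s : S, Function.support s.1)
        ≤ Cardinal.mk S * ⨆ s : S, Cardinal.mk (Function.support s.1) :=
          Cardinal.mk_iUnion_le _
      _ ≤ Cardinal.mk S * Cardinal.aleph0 := by
          gcongr
          exact ciSup_le' fun s => (C0.countable_support s.1).le_aleph0
      _ = Cardinal.mk S := Cardinal.mul_aleph0_eq (Cardinal.aleph0_le_mk S)
  have hzero : ∀ t ∈ S, t γ = 0 := by simpa using hγ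
  obtain ⟨s, hs⟩ := hinf.nonempty
  refine ⟨s, hs, γ, fun t ht => by rw [hzero t ht, hzero s hs], fun t ht hts => ?_⟩
  have : Nonempty Γ := ⟨γ⟩
  obtain ⟨δ, hδ⟩ := C0.exists_abs_sub_eq_dist s t
  rw [hS s hs t ht hts.symm] at hδ
  refine ⟨δ, ?_, hδ⟩
  rintro rfl
  rw [hzero s hs, hzero t ht, sub_zero, abs_zero] at hδ
  exact hl.ne hδ

end C0

theorem IsMaximalEquilateral.nonempty {M : Type*} [MetricSpace M] [Nonempty M] {S : Set M}
    (h : IsMaximalEquilateral S) : S.Nonempty := by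
  by_contra! hS
  obtain ⟨x⟩ := ‹Nonempty M›
  have := h.2 {x} ⟨1, one_pos, by rintro _ rfl _ rfl hne; exact absurd rfl hne⟩ (by simp [hS])
  exact Set.singleton_ne_empty x (this.trans hS)

theorem IsMaximalEquilateral.not_forall_dist_eq {M : Type*} [MetricSpace M] {S : Set M}
    (h : IsMaximalEquilateral S) {l : ℝ} (hl : 0 < l) (hS : IsEquilateralWith S l) (x : M) :
    ¬∀ t ∈ S, dist x t = l := by
  intro hx
  have hins : IsEquilateral (insert x S) := by
    refine ⟨l, hl, ?_⟩
    rintro a (rfl | ha) b (rfl | hb) hab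
    · exact absurd rfl hab
    · exact hx b hb
    · rw [dist_comm]; exact hx a ha
    · exact hS a ha b hb hab
  have hxS : x ∈ S := h.2 _ hins (Set.subset_insert x S) ▸ Set.mem_insert x S
  have := hx x hxS
  rw [dist_self] at this
  exact hl.ne this

theorem C0.mk_le_of_isMaximalEquilateral {Γ : Type u} [TopologicalSpace Γ] [DiscreteTopology Γ]
    [Infinite Γ] {S : Set C₀(Γ, ℝ)} (h : IsMaximalEquilateral S) :
    Cardinal.mk Γ ≤ Cardinal.mk S := by
  by_contra! hcard
  obtain ⟨l, hl, hS⟩ := h.1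
  obtain ⟨s, hs, γ, hmax, hwit⟩ : ∃ s ∈ S, ∃ γ, (∀ t ∈ S, t γ ≤ s γ) ∧
      ∀ t ∈ S, t ≠ s → ∃ δ, δ ≠ γ ∧ |s δ - t δ| = l := by
    rcases S.finite_or_infinite with hfin | hinf
    · exact C0.exists_coordinate_of_finite hfin h.nonempty hS
    · exact C0.exists_coordinate_of_infinite hinf hcard hl hS
  obtain ⟨x, hx⟩ := C0.exists_forall_dist_eq hl hS hs hmax hwit
  exact h.not_forall_dist_eq hl hS x hx

theorem C0.mNum_eq {Γ : Type u} [TopologicalSpace Γ] [DiscreteTopology Γ] [Infinite Γ] :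
    mNum C₀(Γ, ℝ) = Cardinal.mk Γ := by
  have hmem : Cardinal.mk Γ ∈
      {c : Cardinal | ∃ S : Set C₀(Γ, ℝ), IsMaximalEquilateral S ∧ Cardinal.mk S = c} :=
    ⟨_, C0.isMaximalEquilateral_range_indicator, by
      rw [Cardinal.mk_range_eq _ C0.indicator_injective, Cardinal.mk_finset_of_infinite]⟩
  refine le_antisymm (csInf_le' hmem) (le_csInf ⟨_, hmem⟩ ?_)
  rintro _ ⟨S, hS, rfl⟩
  exact C0.mk_le_of_isMaximalEquilateral hS

/-- Proposition 2: for an infinite set `Γ`, the minimum cardinality of a maximal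
equilateral set in `c₀(Γ)` (real functions on the discrete space `Γ` vanishing at infinity,
with the sup norm) equals the cardinality of `Γ`. -/
theorem stmt12 (Γ : Type u) [Infinite Γ] :
    letI : TopologicalSpace Γ := ⊥
    haveI : DiscreteTopology Γ := ⟨rfl⟩
    mNum C₀(Γ, ℝ) = Cardinal.mk Γ := by
  let : TopologicalSpace Γ := ⊥
  have : DiscreteTopology Γ := ⟨rfl⟩
  exact C0.mNum_eq
end

section
/- Let K be a compactification of the discrete space ℕ, i.e., a compact Hausdorff space containing ℕ as a dense subspace consisting of isolated points. Then m(C(K)) = ℵ₀; that is, C(K) contains a countably infinite maximal equilateral set, and this is the minimum possible cardinality. -/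
lemma continuous_ite_of_isClopen {K : Type*} [TopologicalSpace K] {s : Set K}
    (hs : IsClopen s) [∀ x, Decidable (x ∈ s)] {f g : K → ℝ} (hf : Continuous f)
    (hg : Continuous g) : Continuous fun x => if x ∈ s then f x else g x :=
  hf.if (fun x hx => by
    have : x ∈ frontier s := hx
    simp [hs.frontier_eq] at this) hg

/-- If infinitely many points of `K` are isolated, a finite equilateral set in `C(K, ℝ)` can be
enlarged by a point. -/
lemma exists_forall_dist_eq_of_finite {K : Type*} [TopologicalSpace K] [CompactSpace K]
    [T2Space K] (e : ℕ → K) (he : Function.Injective e)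
    (hisol : ∀ n, IsOpen ({e n} : Set K)) {S : Set C(K, ℝ)} (hfin : S.Finite) {l : ℝ}
    (hl : 0 < l) (hS : IsEquilateralWith S l) : ∃ g : C(K, ℝ), ∀ f ∈ S, dist g f = l := by
  classical
  rcases S.eq_empty_or_nonempty with rfl | hne
  · exact ⟨0, by simp⟩
  have hwit : ∀ p : C(K, ℝ) × C(K, ℝ), ∃ x : K,
      p.1 ∈ S → p.2 ∈ S → p.1 ≠ p.2 → l ≤ dist (p.1 x) (p.2 x) := by
    intro p
    by_cases h : p.1 ∈ S ∧ p.2 ∈ S ∧ p.1 ≠ p.2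
    · by_contra! hc
      refine (hS _ h.1 _ h.2.1 h.2.2).not_lt ((ContinuousMap.dist_lt_iff hl).2 fun x => ?_)
      exact (hc x).2.2.2
    · exact ⟨e 0, fun h1 h2 h3 => absurd ⟨h1, h2, h3⟩ h⟩
  choose w hw using hwit
  obtain ⟨y, ⟨n, rfl⟩, hyW⟩ :=
    (Set.infinite_range_of_injective he).exists_notMem_finite ((hfin.prod hfin).image w)
  obtain ⟨f₀, hf₀, hmin⟩ := Set.exists_min_image S (fun f => f (e n)) hfin hne
  let g : C(K, ℝ) := ⟨fun x => if x ∈ ({e n} : Set K) then f₀ x + l else f₀ x,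
    continuous_ite_of_isClopen ⟨isClosed_singleton, hisol n⟩
      (f₀.continuous.add continuous_const) f₀.continuous⟩
  have hgn : g (e n) = f₀ (e n) + l := if_pos rfl
  have hg : ∀ x, x ≠ e n → g x = f₀ x := fun x hx => if_neg hx
  refine ⟨g, fun f hf => le_antisymm ((ContinuousMap.dist_le hl.le).2 fun x => ?_) ?_⟩
  · have hx : dist (f₀ x) (f x) ≤ l := by
      by_cases hff : f₀ = f
      · simp [hff, hl.le]
      · exact (ContinuousMap.dist_apply_le_dist x).trans (hS _ hf₀ _ hf hff).le
    by_cases hxn : x = e n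
    · subst hxn
      have := hmin f hf
      rw [Real.dist_eq, abs_le] at hx ⊢
      rw [hgn]
      constructor <;> linarith [hx.1]
    · rwa [hg x hxn]
  · by_cases hff : f₀ = f
    · subst hff
      refine le_trans ?_ (ContinuousMap.dist_apply_le_dist (e n))
      rw [hgn, Real.dist_eq, add_sub_cancel_left]
      exact le_abs_self l
    · refine le_trans ?_ (ContinuousMap.dist_apply_le_dist (w (f₀, f)))
      rw [hg]
      · exact hw (f₀, f) hf₀ hf hff
      · rintro h
        exact hyW ⟨(f₀, f), ⟨hf₀, hf⟩, h⟩

lemma IsMaximalEquilateral.infinite {K : Type*} [TopologicalSpace K] [CompactSpace K]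
    [T2Space K] (e : ℕ → K) (he : Function.Injective e)
    (hisol : ∀ n, IsOpen ({e n} : Set K)) {S : Set C(K, ℝ)} (hS : IsMaximalEquilateral S) :
    S.Infinite := by
  intro hfin
  obtain ⟨⟨l, hl, hSl⟩, hmax⟩ := hS
  obtain ⟨g, hg⟩ := exists_forall_dist_eq_of_finite e he hisol hfin hl hSl
  have hins : IsEquilateral (insert g S) := by
    refine ⟨l, hl, ?_⟩
    rintro x (rfl | hx) y (rfl | hy) hxy
    · exact absurd rfl hxy
    · exact hg y hy
    · rw [dist_comm]
      exact hg x hx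
    · exact hSl x hx y hy hxy
  have hgS : g ∈ S := hmax _ hins (Set.subset_insert g S) ▸ Set.mem_insert g S
  have := hg g hgS
  rw [dist_self] at this
  exact hl.ne this

open Classical in
/-- The function equal to `0` at `e k` for `k < n`, to `1` at `e n`, and to `1 / 2` elsewhere. -/
noncomputable def stepFun {K : Type*} [TopologicalSpace K] [T2Space K] (e : ℕ → K)
    (hisol : ∀ n, IsOpen ({e n} : Set K)) (n : ℕ) : C(K, ℝ) where
  toFun x := if x ∈ e '' Set.Iio n then 0 else if x ∈ ({e n} : Set K) then 1 else 1 / 2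
  continuous_toFun := by
    refine continuous_ite_of_isClopen
      ⟨((Set.finite_Iio n).image e).isClosed, ?_⟩ continuous_const
      (continuous_ite_of_isClopen ⟨isClosed_singleton, hisol n⟩ continuous_const
        continuous_const)
    rw [← Set.biUnion_of_singleton (e '' Set.Iio n), Set.biUnion_image]
    exact isOpen_biUnion fun k _ => hisol k

section stepFun

variable {K : Type*} [TopologicalSpace K] [T2Space K] {e : ℕ → K}
  {hisol : ∀ n, IsOpen ({e n} : Set K)}

lemma stepFun_of_lt {k n : ℕ} (h : k < n) : stepFun e hisol n (e k) = 0 :=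
  if_pos ⟨k, h, rfl⟩

lemma stepFun_self (he : Function.Injective e) (n : ℕ) : stepFun e hisol n (e n) = 1 := by
  have : e n ∉ e '' Set.Iio n := by
    rintro ⟨k, hk, h⟩
    exact (Set.mem_Iio.1 hk).ne (he h)
  exact (if_neg this).trans (if_pos rfl)

lemma stepFun_of_ne {n : ℕ} {x : K} (h : ∀ k ≤ n, x ≠ e k) :
    stepFun e hisol n x = 1 / 2 := by
  have : x ∉ e '' Set.Iio n := by
    rintro ⟨k, hk, rfl⟩
    exact h k (Set.mem_Iio.1 hk).le rfl
  exact (if_neg this).trans (if_neg (h n le_rfl))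

lemma stepFun_mem_Icc (n : ℕ) (x : K) : stepFun e hisol n x ∈ Set.Icc (0 : ℝ) 1 := by
  simp only [stepFun, ContinuousMap.coe_mk]
  split_ifs <;> norm_num

variable [CompactSpace K]

lemma dist_zero_stepFun (he : Function.Injective e) (n : ℕ) :
    dist (0 : C(K, ℝ)) (stepFun e hisol n) = 1 := by
  refine le_antisymm ((ContinuousMap.dist_le zero_le_one).2 fun x => ?_) ?_
  · have := stepFun_mem_Icc (hisol := hisol) n x
    rw [Real.dist_eq, abs_le, ContinuousMap.zero_apply]
    constructor <;> linarith [this.1, this.2]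
  · refine le_trans ?_ (ContinuousMap.dist_apply_le_dist (e n))
    simp [stepFun_self he, Real.dist_eq]

lemma dist_stepFun_of_lt (he : Function.Injective e) {m n : ℕ} (h : m < n) :
    dist (stepFun e hisol m) (stepFun e hisol n) = 1 := by
  refine le_antisymm ((ContinuousMap.dist_le zero_le_one).2 fun x => ?_) ?_
  · have h₁ := stepFun_mem_Icc (hisol := hisol) m x
    have h₂ := stepFun_mem_Icc (hisol := hisol) n x
    rw [Real.dist_eq, abs_le]
    constructor <;> linarith [h₁.1, h₁.2, h₂.1, h₂.2]
  · refine le_trans ?_ (ContinuousMap.dist_apply_le_dist (e m))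
    simp [stepFun_self he, stepFun_of_lt h]

lemma isEquilateralWith_insert_zero_range_stepFun (he : Function.Injective e) :
    IsEquilateralWith (insert 0 (Set.range (stepFun e hisol))) 1 := by
  rintro x (rfl | ⟨m, rfl⟩) y (rfl | ⟨n, rfl⟩) hxy
  · exact absurd rfl hxy
  · exact dist_zero_stepFun he n
  · rw [dist_comm]
    exact dist_zero_stepFun he m
  · rcases lt_trichotomy m n with h | rfl | h
    · exact dist_stepFun_of_lt he h
    · exact absurd rfl hxy
    · rw [dist_comm]
      exact dist_stepFun_of_lt he h

lemma eq_zero_of_dist_stepFun (he : Function.Injective e) (hdense : DenseRange e)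
    {g : C(K, ℝ)} (hg₀ : dist g 0 = 1) (hg : ∀ n, dist g (stepFun e hisol n) = 1) : g = 0 := by
  have hle : ∀ x, g x ≤ 1 := fun x => by
    have := (ContinuousMap.dist_apply_le_dist (f := g) (g := 0) x).trans hg₀.le
    rw [Real.dist_eq, abs_le, ContinuousMap.zero_apply] at this
    linarith [this.2]
  have hnonneg : ∀ x, 0 ≤ g x := fun x =>
    hdense.induction_on x (isClosed_le continuous_const g.continuous) fun n => by
      have := (ContinuousMap.dist_apply_le_dist (e n)).trans (hg n).le
      rw [Real.dist_eq, abs_le, stepFun_self he] at this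
      linarith [this.1]
  have hzero : ∀ n, g (e n) = 0 := by
    intro n
    induction n using Nat.strong_induction_on with
    | _ n ih =>
      obtain ⟨x, hx⟩ : ∃ x, 1 ≤ dist (g x) (stepFun e hisol n x) := by
        by_contra! hc
        exact (hg n).not_lt ((ContinuousMap.dist_lt_iff one_pos).2 hc)
      rw [Real.dist_eq] at hx
      by_cases hxk : ∃ k ≤ n, x = e k
      · obtain ⟨k, hk, rfl⟩ := hxk
        rcases hk.lt_or_eq with hlt | rfl
        · rw [ih k hlt, stepFun_of_lt hlt] at hx
          norm_num at hx
        · rw [stepFun_self he, abs_of_nonpos (by linarith [hle (e k)])] at hx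
          linarith [hnonneg (e k)]
      · push Not at hxk
        rw [stepFun_of_ne hxk] at hx
        have : |g x - 1 / 2| ≤ 1 / 2 :=
          abs_le.2 ⟨by linarith [hnonneg x], by linarith [hle x]⟩
        linarith
  ext x
  exact hdense.induction_on x (isClosed_eq g.continuous continuous_const) hzero

lemma isMaximalEquilateral_insert_zero_range_stepFun (he : Function.Injective e)
    (hdense : DenseRange e) :
    IsMaximalEquilateral (insert 0 (Set.range (stepFun e hisol))) := by
  have hS := isEquilateralWith_insert_zero_range_stepFun (hisol := hisol) he
  refine ⟨⟨1, one_pos, hS⟩, ?_⟩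
  rintro T ⟨l, -, hT⟩ hST
  have h0 : (0 : C(K, ℝ)) ∈ T := hST (Set.mem_insert _ _)
  have hstep : ∀ n, stepFun e hisol n ∈ T := fun n => hST (Set.mem_insert_of_mem _ ⟨n, rfl⟩)
  have hl : l = 1 := by
    have hd := dist_zero_stepFun (hisol := hisol) he 0
    rw [← hT _ h0 _ (hstep 0) (dist_pos.1 (hd ▸ one_pos)), hd]
  subst hl
  refine Set.Subset.antisymm (fun g hgT => ?_) hST
  by_contra hg
  exact hg (Set.mem_insert_iff.2 <| Or.inl <| eq_zero_of_dist_stepFun (hisol := hisol) he hdense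
    (hT g hgT 0 h0 fun h => hg (h ▸ Set.mem_insert _ _))
    fun n => hT g hgT _ (hstep n) fun h => hg (h ▸ Set.mem_insert_of_mem _ ⟨n, rfl⟩))

end stepFun

/-- Theorem 6: let `K` be a compactification of the discrete space `ℕ`, i.e. a compact
Hausdorff space containing (a copy of) `ℕ` as a dense set of isolated points.  Then the
minimum cardinality of a maximal equilateral set in `C(K)` is `ℵ₀`. -/
theorem stmt17 {K : Type*} [TopologicalSpace K] [CompactSpace K] [T2Space K]
    (e : ℕ → K) (he : Function.Injective e) (hdense : DenseRange e)
    (hisol : ∀ n, IsOpen ({e n} : Set K)) :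
    mNum C(K, ℝ) = Cardinal.aleph0 := by
  have hmax := isMaximalEquilateral_insert_zero_range_stepFun (hisol := hisol) he hdense
  apply le_antisymm
  · refine (csInf_le' ⟨_, hmax, rfl⟩ : mNum C(K, ℝ) ≤ _).trans ?_
    exact Cardinal.mk_le_aleph0_iff.2 ((Set.countable_range _).insert 0).to_subtype
  · refine le_csInf ⟨_, _, hmax, rfl⟩ ?_
    rintro _ ⟨S, hS, rfl⟩
    exact Cardinal.infinite_iff.1 (hS.infinite e he hisol).to_subtype
end
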